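/- Assume Δ > 0, η ≤ Δ²/(36·λ₁*³), and X₀ ∈ R. Then there exists an absolute constant C > 0 (independent of d, r, η, the eigenvalues, and ε) such that for every ε > 0 and every iteration index t ≥ (C/(ηΔ))·log(200·r·λ₁*²/(η·Δ²·ε)), the gradient descent iterate satisfies ‖Σ_r − X_t X_tᵀ‖_F ≤ ε. -/

import Mathlib

open Matrix

/-- The largest singular value of a real matrix. -/
noncomputable def sigmaMax {m n : ℕ} (M : Matrix (Fin m) (Fin n) ℝ) : ℝ :=
  sSup {c : ℝ | ∃ v : EuclideanSpace ℝ (Fin n), ‖v‖ = 1 ∧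
    c = ‖(EuclideanSpace.equiv (Fin m) ℝ).symm (M.mulVec ((EuclideanSpace.equiv (Fin n) ℝ) v))‖}

/-- The smallest singular value (the `n`-th largest, for a matrix with `n` columns). -/
noncomputable def sigmaMin {m n : ℕ} (M : Matrix (Fin m) (Fin n) ℝ) : ℝ :=
  sInf {c : ℝ | ∃ v : EuclideanSpace ℝ (Fin n), ‖v‖ = 1 ∧
    c = ‖(EuclideanSpace.equiv (Fin m) ℝ).symm (M.mulVec ((EuclideanSpace.equiv (Fin n) ℝ) v))‖}

/-- Frobenius norm of a real matrix. -/
noncomputable def frobNorm {m n : ℕ} (M : Matrix (Fin m) (Fin n) ℝ) : ℝ :=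
  Real.sqrt (∑ i, ∑ j, (M i j) ^ 2)

/-- Gradient descent iterates `X_{t+1} = X_t + η (Σ - X_t X_tᵀ) X_t`. -/
noncomputable def gdIter {d r : ℕ} (S : Matrix (Fin d) (Fin d) ℝ) (η : ℝ)
    (X0 : Matrix (Fin d) (Fin r) ℝ) : ℕ → Matrix (Fin d) (Fin r) ℝ
  | 0 => X0
  | t + 1 => gdIter S η X0 t +
      η • ((S - gdIter S η X0 t * (gdIter S η X0 t)ᵀ) * gdIter S η X0 t)

/-- The top `r × r` block `U` (first `r` rows) of `X ∈ ℝ^{d×r}`. -/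
def topBlock {d r : ℕ} (h : r ≤ d) (X : Matrix (Fin d) (Fin r) ℝ) :
    Matrix (Fin r) (Fin r) ℝ :=
  fun i j => X (Fin.castLE h i) j

/-- The bottom `(d-r) × r` block `J` (last `d-r` rows) of `X ∈ ℝ^{d×r}`. -/
def botBlock {d r : ℕ} (X : Matrix (Fin d) (Fin r) ℝ) :
    Matrix (Fin (d - r)) (Fin r) ℝ :=
  fun i j => X ⟨r + (i : ℕ), by have := i.isLt; omega⟩ j

/-- The region `R = {X : σ₁(X)² ≤ 2λ₁*, σ₁(J)² ≤ λ_r* − Δ/2, σ_r(U)² ≥ Δ/4}`. -/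
def inR {d r : ℕ} (h : r ≤ d) (lam1 lamr Δ : ℝ) (X : Matrix (Fin d) (Fin r) ℝ) : Prop :=
  sigmaMax X ^ 2 ≤ 2 * lam1 ∧ sigmaMax (botBlock X) ^ 2 ≤ lamr - Δ / 2 ∧
    Δ / 4 ≤ sigmaMin (topBlock h X) ^ 2

/-- The region `R₂ = {X : σ₁(X)² ≤ 2λ₁*, σ₁(J)² ≤ λ_r* − Δ/2}`. -/
def inR2 {d r : ℕ} (lam1 lamr Δ : ℝ) (X : Matrix (Fin d) (Fin r) ℝ) : Prop :=
  sigmaMax X ^ 2 ≤ 2 * lam1 ∧ sigmaMax (botBlock X) ^ 2 ≤ lamr - Δ / 2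

section GradientStep

open ContinuousLinearMap
open scoped InnerProductSpace

variable {E F G : Type*} [NormedAddCommGroup E] [InnerProductSpace ℝ E] [CompleteSpace E]
  [NormedAddCommGroup F] [InnerProductSpace ℝ F] [CompleteSpace F]
  [NormedAddCommGroup G] [InnerProductSpace ℝ G] [CompleteSpace G]

set_option linter.unusedSectionVars false

/-- For a symmetric operator `0 ≤ T ≤ L`, one has `‖T x‖² ≤ L ⟪T x, x⟫`. -/
theorem norm_sq_apply_le_of_inner_le {T : E →L[ℝ] E} {L : ℝ} (hL : 0 < L)
    (hT : ∀ x y, ⟪T x, y⟫_ℝ = ⟪x, T y⟫_ℝ) (h0 : ∀ x, 0 ≤ ⟪T x, x⟫_ℝ)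
    (h1 : ∀ x, ⟪T x, x⟫_ℝ ≤ L * ‖x‖ ^ 2) (x : E) :
    ‖T x‖ ^ 2 ≤ L * ⟪T x, x⟫_ℝ := by
  have h := h0 (L • x - T x)
  have h' := h1 (T x)
  have e : ⟪T (L • x - T x), L • x - T x⟫_ℝ
      = L ^ 2 * ⟪T x, x⟫_ℝ - 2 * L * ‖T x‖ ^ 2 + ⟪T (T x), T x⟫_ℝ := by
    simp only [map_sub, map_smul, inner_sub_left, inner_sub_right, real_inner_smul_left,
      real_inner_smul_right, hT (T x) x, real_inner_self_eq_norm_sq]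
    ring
  rw [e] at h
  have : 0 ≤ L * (L * ⟪T x, x⟫_ℝ - ‖T x‖ ^ 2) := by nlinarith
  nlinarith [nonneg_of_mul_nonneg_right this hL]

theorem norm_sq_le_of_apply_sq_le {T : E →L[ℝ] F} {c : ℝ} (hc : 0 ≤ c)
    (h : ∀ z, ‖T z‖ ^ 2 ≤ c * ‖z‖ ^ 2) : ‖T‖ ^ 2 ≤ c := by
  have : ‖T‖ ≤ √c := T.opNorm_le_bound (Real.sqrt_nonneg c) fun z => by
    rw [← Real.sqrt_sq (norm_nonneg z), ← Real.sqrt_mul hc]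
    exact Real.le_sqrt_of_sq_le (h z)
  calc ‖T‖ ^ 2 ≤ √c ^ 2 := by gcongr
    _ = c := Real.sq_sqrt hc

/-- The Gram operator `UᵀU + JᵀJ` of the stacked map `(U, J)`. -/
noncomputable def gramSum (U : E →L[ℝ] F) (J : E →L[ℝ] G) : E →L[ℝ] E :=
  adjoint U ∘L U + adjoint J ∘L J

/-- One block of a gradient step, `U + η (A U - U M)`. -/
noncomputable def blockStep (η : ℝ) (A : F →L[ℝ] F) (M : E →L[ℝ] E) (U : E →L[ℝ] F) :
    E →L[ℝ] F :=
  U + η • (A ∘L U - U ∘L M)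

theorem blockStep_apply (η : ℝ) (A : F →L[ℝ] F) (M : E →L[ℝ] E) (U : E →L[ℝ] F) (z : E) :
    blockStep η A M U z = U z + η • (A (U z) - U (M z)) := by
  simp [blockStep]

theorem inner_gramSum_left (U : E →L[ℝ] F) (J : E →L[ℝ] G) (x y : E) :
    ⟪gramSum U J x, y⟫_ℝ = ⟪U x, U y⟫_ℝ + ⟪J x, J y⟫_ℝ := by
  simp [gramSum, inner_add_left, adjoint_inner_left]

theorem inner_gramSum_right (U : E →L[ℝ] F) (J : E →L[ℝ] G) (x y : E) :
    ⟪x, gramSum U J y⟫_ℝ = ⟪U x, U y⟫_ℝ + ⟪J x, J y⟫_ℝ := by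
  simp [gramSum, inner_add_right, adjoint_inner_right]

theorem norm_gramSum_apply_sq_le {U : E →L[ℝ] F} {J : E →L[ℝ] G} {L : ℝ} (hL : 0 < L)
    (hX : ∀ z, ‖U z‖ ^ 2 + ‖J z‖ ^ 2 ≤ L * ‖z‖ ^ 2) (z : E) :
    ‖gramSum U J z‖ ^ 2 ≤ L * (‖U z‖ ^ 2 + ‖J z‖ ^ 2) := by
  have h := norm_sq_apply_le_of_inner_le (T := gramSum U J) hL
    (fun x y => by rw [inner_gramSum_left, inner_gramSum_right])
    (fun x => by
      rw [inner_gramSum_left, real_inner_self_eq_norm_sq, real_inner_self_eq_norm_sq]; positivity)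
    (fun x => by
      rw [inner_gramSum_left, real_inner_self_eq_norm_sq, real_inner_self_eq_norm_sq]; exact hX x) z
  rwa [inner_gramSum_left, real_inner_self_eq_norm_sq, real_inner_self_eq_norm_sq] at h

theorem two_mul_inner_le {L η : ℝ} (hL : 0 < L) (x y : E) :
    2 * η * ⟪x, y⟫_ℝ ≤ ‖x‖ ^ 2 / L + L * η ^ 2 * ‖y‖ ^ 2 := by
  have h : 0 ≤ ‖x - (L * η) • y‖ ^ 2 := by positivity
  rw [norm_sub_sq_real, real_inner_smul_right, norm_smul, mul_pow, Real.norm_eq_abs, sq_abs] at h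
  rw [div_add' _ _ _ hL.ne', le_div_iff₀ hL]
  nlinarith

theorem norm_add_smul_sub_sq_le {l η : ℝ} (hη : 0 ≤ η) {y v m : E} (hv : ‖v‖ ≤ l * ‖y‖) :
    ‖y + η • (v - m)‖ ^ 2 ≤ ‖y‖ ^ 2 + 2 * η * (l * ‖y‖ ^ 2 - ⟪y, m⟫_ℝ)
        + η ^ 2 * (2 * l ^ 2 * ‖y‖ ^ 2 + 2 * ‖m‖ ^ 2) := by
  rw [norm_add_sq_real, real_inner_smul_right, norm_smul, mul_pow, Real.norm_eq_abs, sq_abs,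
    inner_sub_right]
  have i1 : ⟪y, v⟫_ℝ ≤ l * ‖y‖ ^ 2 := by
    nlinarith [real_inner_le_norm y v, norm_nonneg y, mul_le_mul_of_nonneg_left hv (norm_nonneg y)]
  have i2 : ‖v - m‖ ^ 2 ≤ 2 * l ^ 2 * ‖y‖ ^ 2 + 2 * ‖m‖ ^ 2 := by
    have : ‖v - m‖ ^ 2 ≤ (l * ‖y‖ + ‖m‖) ^ 2 := by
      gcongr; exact (norm_sub_le _ _).trans (by linarith)
    nlinarith [sq_nonneg (l * ‖y‖ - ‖m‖)]
  have i3 := mul_le_mul_of_nonneg_left i2 (sq_nonneg η)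
  have i4 := mul_le_mul_of_nonneg_left i1 hη
  linarith

/-- A gradient step keeps the squared operator norm of the stacked map below `2 l`. -/
theorem blockStep_norm_sq_add_le {U : E →L[ℝ] F} {J : E →L[ℝ] G} {A : F →L[ℝ] F}
    {B : G →L[ℝ] G} {l η : ℝ} (hl : 0 < l) (hη : 0 ≤ η) (hηl : η * l ≤ 1 / 36)
    (hX : ∀ z, ‖U z‖ ^ 2 + ‖J z‖ ^ 2 ≤ 2 * l * ‖z‖ ^ 2)
    (hA : ∀ y, ‖A y‖ ≤ l * ‖y‖) (hB : ∀ y, ‖B y‖ ≤ l * ‖y‖) (z : E) :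
    ‖blockStep η A (gramSum U J) U z‖ ^ 2 + ‖blockStep η B (gramSum U J) J z‖ ^ 2
      ≤ 2 * l * ‖z‖ ^ 2 := by
  have hM := norm_gramSum_apply_sq_le (by positivity : (0 : ℝ) < 2 * l) hX z
  have hXM := hX (gramSum U J z)
  have hH := norm_sq_apply_le_of_inner_le
    (T := (2 * l) • ContinuousLinearMap.id ℝ E - gramSum U J)
    (by positivity : (0 : ℝ) < 2 * l)
    (fun x y => by
      simp [inner_sub_left, inner_sub_right, inner_gramSum_left, inner_gramSum_right,
        real_inner_smul_left, real_inner_smul_right])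
    (fun x => by
      simp [inner_sub_left, inner_gramSum_left, real_inner_smul_left]
      linarith [hX x])
    (fun x => by
      simp [inner_sub_left, inner_gramSum_left, real_inner_smul_left]
      positivity) z
  have hC := two_mul_inner_le (η := η) (by positivity : (0 : ℝ) < 2 * l)
    (((2 * l) • ContinuousLinearMap.id ℝ E - gramSum U J) z) (gramSum U J z)
  have eMM : ‖gramSum U J z‖ ^ 2 = ⟪U z, U (gramSum U J z)⟫_ℝ + ⟪J z, J (gramSum U J z)⟫_ℝ := by
    rw [← inner_gramSum_left, real_inner_self_eq_norm_sq]
  have e1 : ⟪((2 * l) • ContinuousLinearMap.id ℝ E - gramSum U J) z, gramSum U J z⟫_ℝ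
      = 2 * l * (‖U z‖ ^ 2 + ‖J z‖ ^ 2) - ‖gramSum U J z‖ ^ 2 := by
    simp [inner_sub_left, inner_gramSum_right, real_inner_smul_left]
    ring
  have e2 : ⟪((2 * l) • ContinuousLinearMap.id ℝ E - gramSum U J) z, z⟫_ℝ
      = 2 * l * ‖z‖ ^ 2 - (‖U z‖ ^ 2 + ‖J z‖ ^ 2) := by
    simp [inner_sub_left, inner_gramSum_left, real_inner_smul_left]
  rw [e2] at hH
  rw [e1] at hC
  generalize ((2 * l) • ContinuousLinearMap.id ℝ E - gramSum U J) z = Hz at *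
  simp only [blockStep_apply]
  generalize gramSum U J z = Mz at *
  have hHd : ‖Hz‖ ^ 2 / (2 * l) ≤ 2 * l * ‖z‖ ^ 2 - (‖U z‖ ^ 2 + ‖J z‖ ^ 2) := by
    rw [div_le_iff₀ (by positivity)]; linarith
  have hU' := norm_add_smul_sub_sq_le (m := U Mz) hη (hA (U z))
  have hJ' := norm_add_smul_sub_sq_le (m := J Mz) hη (hB (J z))
  have hηM := mul_le_mul_of_nonneg_left hM (sq_nonneg η)
  have hηX := mul_le_mul_of_nonneg_left hXM (sq_nonneg η)
  have hll := mul_le_mul_of_nonneg_left hηM hl.le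
  have h14 : 0 ≤ η * l * (1 - 7 * (η * l)) * (‖U z‖ ^ 2 + ‖J z‖ ^ 2) := by
    have : 0 ≤ 1 - 7 * (η * l) := by linarith
    positivity
  nlinarith

/-- A gradient step keeps the lower bound `s` on `UᵀU`, as long as `J` is dominated by `U`. -/
theorem le_blockStep_norm_sq {U : E →L[ℝ] F} {J : E →L[ℝ] G} {A : F →L[ℝ] F}
    {l η s a ω : ℝ} (hl : 0 < l) (hη : 0 ≤ η) (hs0 : 0 ≤ s)
    (hX : ∀ z, ‖U z‖ ^ 2 + ‖J z‖ ^ 2 ≤ 2 * l * ‖z‖ ^ 2)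
    (hA : ∀ y, a * ‖y‖ ^ 2 ≤ ⟪y, A y⟫_ℝ) (hω : ∀ z, ‖J z‖ ^ 2 ≤ ω * ‖U z‖ ^ 2)
    (hs : ∀ z, s * ‖z‖ ^ 2 ≤ ‖U z‖ ^ 2)
    (hc : 2 * η * l ^ 2 * (1 + ω) ≤ a - s * (1 + ω)) (z : E) :
    s * ‖z‖ ^ 2 ≤ ‖blockStep η A (gramSum U J) U z‖ ^ 2 := by
  have hM := norm_gramSum_apply_sq_le (by positivity : (0 : ℝ) < 2 * l) hX z
  have hH := norm_sq_apply_le_of_inner_le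
    (T := adjoint U ∘L U - s • ContinuousLinearMap.id ℝ E)
    (by positivity : (0 : ℝ) < 2 * l)
    (fun x y => by
      simp [inner_sub_left, inner_sub_right, adjoint_inner_left, adjoint_inner_right,
        real_inner_smul_left, real_inner_smul_right])
    (fun x => by
      simp [inner_sub_left, adjoint_inner_left, real_inner_smul_left]
      linarith [hs x])
    (fun x => by
      simp [inner_sub_left, adjoint_inner_left, real_inner_smul_left]
      nlinarith [hX x, sq_nonneg ‖J x‖, mul_nonneg hs0 (sq_nonneg ‖x‖)]) z
  have hC := two_mul_inner_le (η := η) (by positivity : (0 : ℝ) < 2 * l)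
    ((adjoint U ∘L U - s • ContinuousLinearMap.id ℝ E) z) (gramSum U J z)
  have e1 : ⟪(adjoint U ∘L U - s • ContinuousLinearMap.id ℝ E) z, gramSum U J z⟫_ℝ
      = ⟪U z, U (gramSum U J z)⟫_ℝ - s * (‖U z‖ ^ 2 + ‖J z‖ ^ 2) := by
    simp [inner_sub_left, inner_gramSum_right, real_inner_smul_left, adjoint_inner_left]
    ring
  have e2 : ⟪(adjoint U ∘L U - s • ContinuousLinearMap.id ℝ E) z, z⟫_ℝ
      = ‖U z‖ ^ 2 - s * ‖z‖ ^ 2 := by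
    simp [inner_sub_left, adjoint_inner_left, real_inner_smul_left]
  rw [e2] at hH
  rw [e1] at hC
  generalize (adjoint U ∘L U - s • ContinuousLinearMap.id ℝ E) z = Hz at *
  simp only [blockStep_apply]
  generalize gramSum U J z = Mz at *
  have hHd : ‖Hz‖ ^ 2 / (2 * l) ≤ ‖U z‖ ^ 2 - s * ‖z‖ ^ 2 := by
    rw [div_le_iff₀ (by positivity)]; linarith
  rw [norm_add_sq_real, real_inner_smul_right, inner_sub_right]
  have h0 := sq_nonneg ‖η • (A (U z) - U Mz)‖
  have h1 := mul_le_mul_of_nonneg_left (hA (U z)) hη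
  have h2 := mul_le_mul_of_nonneg_left (hω z) (mul_nonneg hη hs0)
  have h3 := mul_le_mul_of_nonneg_left hM (mul_nonneg hl.le (sq_nonneg η))
  have h4 := mul_le_mul_of_nonneg_left (hω z) (mul_nonneg (sq_nonneg l) (sq_nonneg η))
  have h5 := mul_le_mul_of_nonneg_right hc (mul_nonneg hη (sq_nonneg ‖U z‖))
  nlinarith

/-- A gradient step contracts the ratio between `‖J z‖` and `‖U z‖`. -/
theorem blockStep_ratio_le {U : E →L[ℝ] F} {J : E →L[ℝ] G} {A : F →L[ℝ] F}
    {B : G →L[ℝ] G} {l η a b w : ℝ} (hl : 0 < l) (hη : 0 ≤ η) (hηl : η * l ≤ 1 / 36)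
    (hX : ∀ z, ‖U z‖ ^ 2 + ‖J z‖ ^ 2 ≤ 2 * l * ‖z‖ ^ 2)
    (hA : ∀ y, a * ‖y‖ ^ 2 ≤ ⟪y, A y⟫_ℝ) (hA' : ∀ y, ‖A y‖ ≤ l * ‖y‖)
    (hB : ∀ x, ‖B x‖ ≤ b * ‖x‖) (hb : 0 ≤ b) (hab : b < a) (hal : a ≤ l) (hw : 0 ≤ w)
    (hJU : ∀ z, ‖J z‖ ≤ w * ‖U z‖) (hc : 12 * η * l ^ 2 * (1 + w) ≤ a - b) (z : E) :
    ‖blockStep η B (gramSum U J) J z‖ ≤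
      (1 - η * (a - b) / 4) * w * ‖blockStep η A (gramSum U J) U z‖ := by
  have hU2 : ‖U‖ ^ 2 ≤ 2 * l := norm_sq_le_of_apply_sq_le (by positivity) fun z => by
    nlinarith [hX z, sq_nonneg ‖J z‖]
  have hJ2 : ‖J‖ ^ 2 ≤ 2 * l := norm_sq_le_of_apply_sq_le (by positivity) fun z => by
    nlinarith [hX z, sq_nonneg ‖U z‖]
  have hUJ : ‖U‖ * ‖J‖ ≤ 2 * l := by nlinarith [sq_nonneg (‖U‖ - ‖J‖)]
  have hq : ‖U (gramSum U J z)‖ ≤ 2 * l * (1 + w) * ‖U z‖ := by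
    have e : U (gramSum U J z) = U (adjoint U (U z)) + U (adjoint J (J z)) := by
      simp [gramSum]
    have h1 : ‖U (adjoint U (U z))‖ ≤ 2 * l * ‖U z‖ := by
      calc _ ≤ ‖U‖ * (‖adjoint U‖ * ‖U z‖) := U.le_of_opNorm_le_of_le le_rfl (le_opNorm _ _)
        _ = ‖U‖ ^ 2 * ‖U z‖ := by rw [LinearIsometryEquiv.norm_map]; ring
        _ ≤ _ := by gcongr
    have h2 : ‖U (adjoint J (J z))‖ ≤ 2 * l * (w * ‖U z‖) := by
      calc _ ≤ ‖U‖ * (‖adjoint J‖ * ‖J z‖) := U.le_of_opNorm_le_of_le le_rfl (le_opNorm _ _)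
        _ = ‖U‖ * ‖J‖ * ‖J z‖ := by rw [LinearIsometryEquiv.norm_map]; ring
        _ ≤ _ := by gcongr; exact hJU z
    rw [e]
    exact (norm_add_le _ _).trans (by linarith)
  simp only [blockStep_apply]
  have hJM := hJU (gramSum U J z)
  set Mz := gramSum U J z
  set v := z - η • Mz with hv
  have hz : z = v + η • Mz := by rw [hv]; abel
  have eU : U z + η • (A (U z) - U Mz) = (U v + η • A (U v)) + (η * η) • A (U Mz) := by
    rw [hz]; simp only [map_add, map_smul]; module
  have eJ : J z + η • (B (J z) - J Mz) = J v + η • B (J v) + (η * η) • B (J Mz) := by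
    rw [hz]; simp only [map_add, map_smul]; module
  have hUz : ‖U z‖ ≤ ‖U v‖ + η * ‖U Mz‖ := by
    conv_lhs => rw [hz]
    rw [map_add, map_smul]
    refine (norm_add_le _ _).trans ?_
    rw [norm_smul, Real.norm_of_nonneg hη]
  have hJv := hJU v
  have hlow : (1 + η * a) * ‖U v‖ ≤ ‖U v + η • A (U v)‖ := by
    rcases (norm_nonneg (U v)).eq_or_lt with h | h
    · rw [← h]; simp
    · have i := real_inner_le_norm (U v) (U v + η • A (U v))
      rw [inner_add_right, real_inner_smul_right, real_inner_self_eq_norm_sq] at i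
      have := mul_le_mul_of_nonneg_left (hA (U v)) hη
      refine le_of_mul_le_mul_left ?_ h
      nlinarith
  have hlow' : (1 + η * a) * ‖U v‖ - η * l * (η * ‖U Mz‖)
      ≤ ‖U z + η • (A (U z) - U Mz)‖ := by
    rw [eU]
    have h1 := norm_sub_le_norm_add (U v + η • A (U v)) ((η * η) • A (U Mz))
    rw [norm_smul, Real.norm_of_nonneg (mul_nonneg hη hη)] at h1
    have h2 := mul_le_mul_of_nonneg_left (hA' (U Mz)) (mul_nonneg hη hη)
    linarith
  have hup : ‖J z + η • (B (J z) - J Mz)‖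
      ≤ w * ((1 + η * b) * ‖U v‖ + η * b * (η * ‖U Mz‖)) := by
    rw [eJ]
    have h1 := norm_add₃_le (a := J v) (b := η • B (J v)) (c := (η * η) • B (J Mz))
    rw [norm_smul, norm_smul, Real.norm_of_nonneg (mul_nonneg hη hη),
      Real.norm_of_nonneg hη] at h1
    have h2 := mul_le_mul_of_nonneg_left (hB (J v)) hη
    have h3 := mul_le_mul_of_nonneg_left (hB (J Mz)) (mul_nonneg hη hη)
    have h4 := mul_le_mul_of_nonneg_left hJv (mul_nonneg hη hb)
    have h5 := mul_le_mul_of_nonneg_left hJM (mul_nonneg (mul_nonneg hη hη) hb)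
    linarith
  set u := ‖U v‖
  have hu : 0 ≤ u := norm_nonneg _
  set m := η * ‖U Mz‖ with hm
  have hm0 : 0 ≤ m := by positivity
  -- the second order term is small
  have hlm : l * m ≤ (a - b) / 5 * u := by
    have h1 : m ≤ 2 * η * l * (1 + w) * (u + m) := by
      have := mul_le_mul_of_nonneg_left hq hη
      have h' := mul_le_mul_of_nonneg_left hUz (by positivity : 0 ≤ 2 * η * l * (1 + w))
      linarith
    have h2 : l * m ≤ (a - b) / 6 * (u + m) := by
      have h3 := mul_le_mul_of_nonneg_left h1 hl.le
      have h4 := mul_le_mul_of_nonneg_right hc (add_nonneg hu hm0)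
      nlinarith
    have h5 : (a - b) * m ≤ l * m := by gcongr; linarith
    linarith
  have hηa : η * a ≤ 1 / 36 := (mul_le_mul_of_nonneg_left hal hη).trans hηl
  have hμ0 : 0 ≤ 1 - η * (a - b) / 4 := by nlinarith
  have hμ1 : 1 - η * (a - b) / 4 ≤ 1 := by nlinarith
  have hfin : (1 + η * b) * u + η * b * m
      ≤ (1 - η * (a - b) / 4) * ((1 + η * a) * u - η * l * m) := by
    have h1 : η * b * m ≤ η * (l * m) := by
      have : b * m ≤ l * m := by gcongr; linarith
      nlinarith
    have h2 : (1 - η * (a - b) / 4) * (η * (l * m)) ≤ η * (l * m) :=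
      mul_le_of_le_one_left (by positivity) hμ1
    have h3 := mul_le_mul_of_nonneg_left hlm hη
    have h4 : η * (a - b) * u * (η * a) ≤ η * (a - b) * u * (1 / 36) :=
      mul_le_mul_of_nonneg_left hηa
        (mul_nonneg (mul_nonneg hη (by linarith)) hu)
    have h5 : 0 ≤ η * (a - b) * u := mul_nonneg (mul_nonneg hη (by linarith)) hu
    linarith
  calc _ ≤ _ := hup
    _ ≤ w * ((1 - η * (a - b) / 4) * ((1 + η * a) * u - η * l * m)) := by gcongr
    _ = (1 - η * (a - b) / 4) * w * ((1 + η * a) * u - η * l * m) := by ring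
    _ ≤ _ := by gcongr

/-- If `s ≤ UUᵀ` and `‖U‖² ≤ 2 l`, then `‖1 - 2 η UUᵀ‖ ≤ 1 - 2 η s` for small `η`. -/
theorem norm_id_sub_smul_comp_adjoint_le {U : E →L[ℝ] F} {l η s : ℝ} (hη : 0 ≤ η)
    (hηl : η * l ≤ 1 / 36) (hsl : s ≤ l) (hU2 : ‖U‖ ^ 2 ≤ 2 * l)
    (hs : ∀ y, s * ‖y‖ ^ 2 ≤ ‖adjoint U y‖ ^ 2) :
    ‖ContinuousLinearMap.id ℝ F - (2 * η) • (U ∘L adjoint U)‖ ≤ 1 - 2 * η * s := by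
  have hc0 : 0 < 1 - 2 * η * s := by nlinarith
  have hSi : ∀ x, ⟪(U ∘L adjoint U) x, x⟫_ℝ = ‖adjoint U x‖ ^ 2 := fun x => by
    simp [← adjoint_inner_right]
  have hTi : ∀ x, ⟪(ContinuousLinearMap.id ℝ F - (2 * η) • (U ∘L adjoint U)) x, x⟫_ℝ
      = ‖x‖ ^ 2 - 2 * η * ‖adjoint U x‖ ^ 2 := fun x => by
    rw [← hSi]
    simp [inner_sub_left, real_inner_smul_left]
  have hTs : ∀ x y, ⟪(ContinuousLinearMap.id ℝ F - (2 * η) • (U ∘L adjoint U)) x, y⟫_ℝ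
      = ⟪x, (ContinuousLinearMap.id ℝ F - (2 * η) • (U ∘L adjoint U)) y⟫_ℝ := fun x y => by
    simp [inner_sub_left, inner_sub_right, real_inner_smul_left, real_inner_smul_right,
      ← adjoint_inner_right U, ← adjoint_inner_left U]
  generalize ContinuousLinearMap.id ℝ F - (2 * η) • (U ∘L adjoint U) = T at *
  have hSle : ∀ x, ‖adjoint U x‖ ^ 2 ≤ 2 * l * ‖x‖ ^ 2 := fun x => by
    have h1 := (adjoint U).le_opNorm x
    rw [LinearIsometryEquiv.norm_map] at h1
    calc _ ≤ (‖U‖ * ‖x‖) ^ 2 := by gcongr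
      _ = ‖U‖ ^ 2 * ‖x‖ ^ 2 := by ring
      _ ≤ _ := by gcongr
  refine opNorm_le_bound _ hc0.le fun x => ?_
  have hle : ∀ x, ⟪T x, x⟫_ℝ ≤ (1 - 2 * η * s) * ‖x‖ ^ 2 := fun x => by
    rw [hTi]
    nlinarith [mul_le_mul_of_nonneg_left (hs x) hη]
  have hsq := norm_sq_apply_le_of_inner_le hc0 hTs (fun x => by
    rw [hTi]
    nlinarith [mul_le_mul_of_nonneg_left (hSle x) hη,
      mul_le_mul_of_nonneg_right hηl (sq_nonneg ‖x‖), sq_nonneg ‖x‖]) hle x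
  refine le_of_sq_le_sq ?_ (by positivity)
  rw [mul_pow]
  nlinarith [mul_le_mul_of_nonneg_left (hle x) hc0.le]

/-- Expansion of the residual of `U + η (P U - Q)`, where `P` is the residual of `U`. -/
theorem sub_step_comp_adjoint_eq (U Q : E →L[ℝ] F) {P S T : F →L[ℝ] F} (η : ℝ)
    (hS : S = U ∘L adjoint U) (hT : T = ContinuousLinearMap.id ℝ F - (2 * η) • S)
    (hPa : adjoint P = P) {V : E →L[ℝ] F} (hV : V = U + η • (P ∘L U)) :
    (P + S) - (V - η • Q) ∘L adjoint (V - η • Q) =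
      (1 / 2 : ℝ) • (T ∘L P + P ∘L T) - η ^ 2 • (P ∘L S ∘L P)
        + η • (V ∘L adjoint Q + Q ∘L adjoint V) - η ^ 2 • (Q ∘L adjoint Q) := by
  have hVV : V ∘L adjoint V = S + η • (P ∘L S + S ∘L P) + η ^ 2 • (P ∘L S ∘L P) := by
    have : adjoint V = adjoint U + η • (adjoint U ∘L P) := by
      simp [hV, adjoint_comp, hPa]
    rw [this]
    ext y; simp [hV, hS]; module
  have : adjoint (V - η • Q) = adjoint V - η • adjoint Q := by simp
  rw [this]
  have h2 : (V - η • Q) ∘L (adjoint V - η • adjoint Q) = V ∘L adjoint V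
      - η • (V ∘L adjoint Q + Q ∘L adjoint V) + η ^ 2 • (Q ∘L adjoint Q) := by
    ext y; simp; module
  rw [h2, hVV]
  ext y; simp [hT]; module

set_option maxHeartbeats 1000000 in
/-- The residual `A - UUᵀ` contracts along a gradient step, up to an error of order `‖J‖²`. -/
theorem norm_sub_blockStep_le {U : E →L[ℝ] F} {J : E →L[ℝ] G} {A : F →L[ℝ] F}
    {l η s : ℝ} (hl : 0 < l) (hη : 0 ≤ η) (hηl : η * l ≤ 1 / 36) (hsl : s ≤ l)
    (hU2 : ‖U‖ ^ 2 ≤ 2 * l) (hJ2 : ‖J‖ ^ 2 ≤ 2 * l)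
    (hAs : adjoint A = A) (hA : ‖A‖ ≤ l)
    (hs : ∀ y, s * ‖y‖ ^ 2 ≤ ‖adjoint U y‖ ^ 2) :
    ‖A - blockStep η A (gramSum U J) U ∘L adjoint (blockStep η A (gramSum U J) U)‖
      ≤ (1 - 2 * η * s + 6 * η ^ 2 * l ^ 2) * ‖A - U ∘L adjoint U‖
        + 10 * η * l * ‖J‖ ^ 2 := by
  obtain ⟨S, hS⟩ : ∃ S, S = U ∘L adjoint U := ⟨_, rfl⟩
  obtain ⟨P, hP⟩ : ∃ P, P = A - S := ⟨_, rfl⟩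
  obtain ⟨V, hV⟩ : ∃ V, V = U + η • (P ∘L U) := ⟨_, rfl⟩
  obtain ⟨Q, hQ⟩ : ∃ Q, Q = U ∘L adjoint J ∘L J := ⟨_, rfl⟩
  have hSa : adjoint S = S := by simp [hS, adjoint_comp]
  have hPa : adjoint P = P := by simp [hP, hAs, hSa]
  have hstep : blockStep η A (gramSum U J) U = V - η • Q := by
    ext z; simp [blockStep, gramSum, hV, hP, hS, hQ]; module
  have hSn : ‖S‖ ≤ 2 * l := by
    rw [hS]
    refine (opNorm_comp_le _ _).trans ?_
    rw [LinearIsometryEquiv.norm_map]; linarith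
  have hPn : ‖P‖ ≤ 3 * l := by
    rw [hP]
    exact (norm_sub_le _ _).trans (by linarith)
  obtain ⟨T, hT⟩ : ∃ T, T = ContinuousLinearMap.id ℝ F - (2 * η) • S := ⟨_, rfl⟩
  have hc0 : 0 < 1 - 2 * η * s := by nlinarith
  have hTn : ‖T‖ ≤ 1 - 2 * η * s := by
    rw [hT, hS]
    exact norm_id_sub_smul_comp_adjoint_le hη hηl hsl hU2 hs
  have hAP : A = P + S := by rw [hP]; abel
  rw [hstep, ← hS, ← hP, hAP, sub_step_comp_adjoint_eq U Q η hS hT hPa hV]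
  have hUn : ‖adjoint U‖ = ‖U‖ := LinearIsometryEquiv.norm_map _ _
  have hηl0 : 0 ≤ η * l := by positivity
  have hVn : ‖V‖ ≤ 13 / 12 * ‖U‖ := by
    have h1 : ‖η • (P ∘L U)‖ ≤ η * (3 * l * ‖U‖) := by
      rw [norm_smul, Real.norm_of_nonneg hη]
      gcongr
      exact (opNorm_comp_le _ _).trans (by gcongr)
    have h2 := mul_le_mul_of_nonneg_right hηl (norm_nonneg U)
    rw [hV]
    exact (norm_add_le _ _).trans (by linarith)
  have hQn : ‖Q‖ ≤ ‖U‖ * ‖J‖ ^ 2 := by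
    rw [hQ]
    refine (opNorm_comp_le _ _).trans ?_
    gcongr
    refine (opNorm_comp_le _ _).trans ?_
    rw [LinearIsometryEquiv.norm_map]; linarith
  have h1 : ‖(1 / 2 : ℝ) • (T ∘L P + P ∘L T)‖ ≤ (1 - 2 * η * s) * ‖P‖ := by
    rw [norm_smul, Real.norm_of_nonneg (by norm_num)]
    have i1 : ‖T ∘L P‖ ≤ (1 - 2 * η * s) * ‖P‖ := (opNorm_comp_le _ _).trans (by gcongr)
    have i2 : ‖P ∘L T‖ ≤ ‖P‖ * (1 - 2 * η * s) := (opNorm_comp_le _ _).trans (by gcongr)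
    have i3 := norm_add_le (T ∘L P) (P ∘L T)
    linarith
  have h2 : ‖η ^ 2 • (P ∘L S ∘L P)‖ ≤ 6 * η ^ 2 * l ^ 2 * ‖P‖ := by
    rw [norm_smul, Real.norm_of_nonneg (by positivity)]
    calc η ^ 2 * ‖P ∘L S ∘L P‖ ≤ η ^ 2 * (‖P‖ * (‖S‖ * ‖P‖)) := by
          gcongr
          exact (opNorm_comp_le _ _).trans (by gcongr; exact opNorm_comp_le _ _)
      _ ≤ η ^ 2 * (3 * l * (2 * l * ‖P‖)) := by gcongr
      _ = _ := by ring
  have h3 : ‖η • (V ∘L adjoint Q + Q ∘L adjoint V)‖ ≤ η * (5 * l * ‖J‖ ^ 2) := by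
    rw [norm_smul, Real.norm_of_nonneg hη]
    gcongr
    have i1 : ‖V ∘L adjoint Q‖ ≤ ‖V‖ * ‖Q‖ := by
      have := opNorm_comp_le V (adjoint Q)
      rwa [LinearIsometryEquiv.norm_map] at this
    have i2 : ‖Q ∘L adjoint V‖ ≤ ‖Q‖ * ‖V‖ := by
      have := opNorm_comp_le Q (adjoint V)
      rwa [LinearIsometryEquiv.norm_map] at this
    have i3 : ‖V‖ * ‖Q‖ ≤ 13 / 12 * ‖U‖ * (‖U‖ * ‖J‖ ^ 2) := by gcongr
    have i4 := mul_le_mul_of_nonneg_right hU2 (sq_nonneg ‖J‖)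
    have i5 : 0 ≤ l * ‖J‖ ^ 2 := by positivity
    have i6 := norm_add_le (V ∘L adjoint Q) (Q ∘L adjoint V)
    nlinarith
  have h4 : ‖η ^ 2 • (Q ∘L adjoint Q)‖ ≤ η * l * ‖J‖ ^ 2 := by
    rw [norm_smul, Real.norm_of_nonneg (by positivity)]
    have i1 : ‖Q ∘L adjoint Q‖ ≤ ‖Q‖ * ‖Q‖ := by
      have := opNorm_comp_le Q (adjoint Q)
      rwa [LinearIsometryEquiv.norm_map] at this
    calc η ^ 2 * ‖Q ∘L adjoint Q‖ ≤ η ^ 2 * ((‖U‖ * ‖J‖ ^ 2) * (‖U‖ * ‖J‖ ^ 2)) := by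
          gcongr
          exact i1.trans (by gcongr)
      _ = η ^ 2 * (‖U‖ ^ 2 * ‖J‖ ^ 2) * ‖J‖ ^ 2 := by ring
      _ ≤ η ^ 2 * ((2 * l) * (2 * l)) * ‖J‖ ^ 2 := by gcongr
      _ = 4 * (η * l) * (η * l) * ‖J‖ ^ 2 := by ring
      _ ≤ 4 * (1 / 36) * (η * l) * ‖J‖ ^ 2 := by gcongr
      _ ≤ _ := by nlinarith [mul_nonneg hηl0 (sq_nonneg ‖J‖)]
  have i0 : 0 ≤ η * l * ‖J‖ ^ 2 := by positivity
  refine (norm_sub_le _ _).trans ?_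
  have t1 := norm_add_le ((1 / 2 : ℝ) • (T ∘L P + P ∘L T) - η ^ 2 • (P ∘L S ∘L P))
    (η • (V ∘L adjoint Q + Q ∘L adjoint V))
  have t2 := norm_sub_le ((1 / 2 : ℝ) • (T ∘L P + P ∘L T)) (η ^ 2 • (P ∘L S ∘L P))
  linarith

theorem sq_norm_le_norm_adjoint_apply_sq [FiniteDimensional ℝ E] {U : E →L[ℝ] E} {s : ℝ}
    (hs0 : 0 < s) (hs : ∀ z, s * ‖z‖ ^ 2 ≤ ‖U z‖ ^ 2) (y : E) :
    s * ‖y‖ ^ 2 ≤ ‖adjoint U y‖ ^ 2 := by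
  have hinj : Function.Injective U := (injective_iff_map_eq_zero U).2 fun z hz => by
    have := hs z
    rw [hz, norm_zero] at this
    have : ‖z‖ ^ 2 ≤ 0 := by nlinarith
    simpa using this
  obtain ⟨z, rfl⟩ := (LinearMap.injective_iff_surjective (f := U.toLinearMap)).1 hinj y
  change s * ‖U z‖ ^ 2 ≤ ‖adjoint U (U z)‖ ^ 2
  have h1 : ‖U z‖ ^ 2 ≤ ‖adjoint U (U z)‖ * ‖z‖ := by
    rw [← real_inner_self_eq_norm_sq, ← adjoint_inner_left]
    exact real_inner_le_norm _ _
  rcases eq_or_ne z 0 with rfl | hz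
  · simp
  have hz' : 0 < ‖z‖ ^ 2 := by positivity
  have h2 : (‖U z‖ ^ 2) ^ 2 ≤ ‖adjoint U (U z)‖ ^ 2 * ‖z‖ ^ 2 := by
    rw [← mul_pow]; gcongr
  refine le_of_mul_le_mul_right ?_ hz'
  nlinarith [mul_le_mul_of_nonneg_right (hs z) (sq_nonneg ‖U z‖)]

theorem residual_recursion {η l Δ K p p' j q : ℝ} (hη : 0 ≤ η) (hl : 0 ≤ l)
    (hηl : 36 * η * l ^ 2 ≤ Δ) (hηΔ0 : 0 ≤ η * Δ) (hηΔ : η * Δ ≤ 1 / 36)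
    (hK0 : 0 ≤ K) (hK : K * Δ = 120 * l ^ 2) (hp : 0 ≤ p) (hq : 0 ≤ q)
    (hp' : p' ≤ (1 - 2 * η * (Δ / 8) + 6 * η ^ 2 * l ^ 2) * p + 10 * η * l * j)
    (hj : j ≤ 2 * l * q) :
    p' + K * ((1 - η * Δ / 4) ^ 2 * q) ≤ (1 - η * Δ / 12) * (p + K * q) := by
  have h1 : (1 - 2 * η * (Δ / 8) + 6 * η ^ 2 * l ^ 2) * p ≤ (1 - η * Δ / 12) * p := by
    gcongr
    nlinarith [mul_le_mul_of_nonneg_left hηl hη]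
  have h2 := mul_le_mul_of_nonneg_left hj (by positivity : 0 ≤ 10 * η * l)
  have h3 : K * ((1 - η * Δ / 4) ^ 2 * q) ≤ K * ((1 - η * Δ / 4) * q) := by
    gcongr
    nlinarith
  have h4 : K * ((1 - η * Δ / 12) * q) - K * ((1 - η * Δ / 4) * q) = K * Δ * (η * q / 6) := by
    ring
  rw [hK] at h4
  linarith

set_option maxHeartbeats 1000000 in
/-- Gradient descent in block form converges linearly from a good initialization. -/
theorem blockStep_iterate_bounds [FiniteDimensional ℝ E] {U : ℕ → E →L[ℝ] E} {J : ℕ → E →L[ℝ] G}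
    {A : E →L[ℝ] E} {B : G →L[ℝ] G} {l η a b w : ℝ} (hη : 0 < η)
    (hUs : ∀ t, U (t + 1) = blockStep η A (gramSum (U t) (J t)) (U t))
    (hJs : ∀ t, J (t + 1) = blockStep η B (gramSum (U t) (J t)) (J t))
    (hAs : adjoint A = A) (hA : ∀ y, a * ‖y‖ ^ 2 ≤ ⟪y, A y⟫_ℝ) (hA' : ∀ y, ‖A y‖ ≤ l * ‖y‖)
    (hB : ∀ x, ‖B x‖ ≤ b * ‖x‖) (hb : 0 ≤ b) (hab : b < a) (hal : a ≤ l)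
    (hηl : 36 * η * l ^ 3 ≤ (a - b) ^ 2)
    (hX : ∀ z, ‖U 0 z‖ ^ 2 + ‖J 0 z‖ ^ 2 ≤ 2 * l * ‖z‖ ^ 2)
    (hs : ∀ z, (a - b) / 8 * ‖z‖ ^ 2 ≤ ‖U 0 z‖ ^ 2)
    (hw : 0 ≤ w) (hJU : ∀ z, ‖J 0 z‖ ≤ w * ‖U 0 z‖)
    (hwa : (1 + w ^ 2) * (a - b) ≤ 4 * a) (hwl : w * (a - b) ≤ 2 * l) (t : ℕ) :
    ‖A - U t ∘L adjoint (U t)‖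
        ≤ (1 - η * (a - b) / 12) ^ t * (3 * l + 120 * l ^ 2 * w ^ 2 / (a - b)) ∧
      ‖U t‖ ^ 2 ≤ 2 * l ∧ ‖J t‖ ^ 2 ≤ 2 * l ∧
      ‖J t‖ ^ 2 ≤ 2 * l * ((1 - η * (a - b) / 12) ^ t * w) ^ 2 := by
  have hΔ : 0 < a - b := by linarith
  have ha : 0 < a := by linarith
  have hl : 0 < l := by linarith
  have hΔl : a - b ≤ l := by linarith
  have hηl2 : 36 * η * l ^ 2 ≤ a - b := by
    have : 36 * η * l ^ 2 * l ≤ (a - b) * l := by nlinarith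
    exact le_of_mul_le_mul_right this hl
  have hηl1 : η * l ≤ 1 / 36 := by
    have : η * l * l ≤ 1 / 36 * l := by nlinarith
    exact le_of_mul_le_mul_right this hl
  have hηΔ : η * (a - b) ≤ 1 / 36 := (mul_le_mul_of_nonneg_left hΔl hη.le).trans hηl1
  have hηΔ0 : 0 < η * (a - b) := by positivity
  set μ := 1 - η * (a - b) / 4 with hμ
  set ρ := 1 - η * (a - b) / 12 with hρ
  have hμ0 : 0 ≤ μ := by linarith
  have hμ1 : μ ≤ 1 := by linarith
  have hμρ : μ ≤ ρ := by linarith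
  have inv : ∀ t, (∀ z, ‖U t z‖ ^ 2 + ‖J t z‖ ^ 2 ≤ 2 * l * ‖z‖ ^ 2) ∧
      (∀ z, (a - b) / 8 * ‖z‖ ^ 2 ≤ ‖U t z‖ ^ 2) ∧
      (∀ z, ‖J t z‖ ≤ μ ^ t * w * ‖U t z‖) := by
    intro t
    induction t with
    | zero => exact ⟨hX, hs, by simpa using hJU⟩
    | succ t ih =>
      obtain ⟨iX, iS, iR⟩ := ih
      have hμt : μ ^ t * w ≤ w := mul_le_of_le_one_left hw (pow_le_one₀ hμ0 hμ1)
      have hμt0 : 0 ≤ μ ^ t * w := by positivity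
      rw [hUs, hJs]
      refine ⟨blockStep_norm_sq_add_le hl hη.le hηl1 iX hA' fun y => (hB y).trans ?_, ?_, ?_⟩
      · gcongr; linarith
      · refine le_blockStep_norm_sq (ω := w ^ 2) hl hη.le (by linarith) iX hA (fun z => ?_) iS ?_
        · rw [← mul_pow]
          gcongr
          exact (iR z).trans (by gcongr)
        · have : 36 * η * l ^ 2 * (1 + w ^ 2) ≤ (a - b) * (1 + w ^ 2) := by gcongr
          linarith
      · intro z
        have := blockStep_ratio_le hl hη.le hηl1 iX hA hA' hB hb hab hal hμt0 iR ?_ z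
        · have e : μ ^ (t + 1) * w = μ * (μ ^ t * w) := by ring
          rw [e]
          exact this
        · have h1 : (1 + w) * (a - b) ≤ 3 * l := by linarith
          have h2 : 12 * η * l ^ 2 * ((1 + w) * (a - b)) ≤ (a - b) * (a - b) := by
            have := mul_le_mul_of_nonneg_left h1 (by positivity : 0 ≤ 12 * η * l ^ 2)
            nlinarith
          have h3 : 12 * η * l ^ 2 * (1 + w) ≤ a - b := by
            refine le_of_mul_le_mul_right ?_ hΔ
            linarith
          refine le_trans ?_ h3
          gcongr
  have hU2 : ∀ t, ‖U t‖ ^ 2 ≤ 2 * l := fun t =>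
    norm_sq_le_of_apply_sq_le (by positivity) fun z => by
      nlinarith [(inv t).1 z, sq_nonneg ‖J t z‖]
  have hJ2 : ∀ t, ‖J t‖ ^ 2 ≤ 2 * l := fun t =>
    norm_sq_le_of_apply_sq_le (by positivity) fun z => by
      nlinarith [(inv t).1 z, sq_nonneg ‖U t z‖]
  have hJw : ∀ t, ‖J t‖ ^ 2 ≤ 2 * l * (μ ^ t * w) ^ 2 := fun t =>
    norm_sq_le_of_apply_sq_le (by positivity) fun z => by
      calc ‖J t z‖ ^ 2 ≤ (μ ^ t * w * ‖U t z‖) ^ 2 := by gcongr; exact (inv t).2.2 z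
        _ = (μ ^ t * w) ^ 2 * ‖U t z‖ ^ 2 := by ring
        _ ≤ (μ ^ t * w) ^ 2 * (2 * l * ‖z‖ ^ 2) := by
          gcongr
          nlinarith [(inv t).1 z, sq_nonneg ‖J t z‖]
        _ = _ := by ring
  have hAn : ‖A‖ ≤ l := A.opNorm_le_bound hl.le hA'
  set K := 120 * l ^ 2 / (a - b) with hK
  have hK0 : 0 ≤ K := by positivity
  have hKΔ : K * (a - b) = 120 * l ^ 2 := by rw [hK]; field_simp
  have hP : ∀ t, ‖A - U t ∘L adjoint (U t)‖ + K * (μ ^ t * w) ^ 2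
      ≤ ρ ^ t * (3 * l + K * w ^ 2) := by
    intro t
    induction t with
    | zero =>
      have h1 := norm_sub_le A (U 0 ∘L adjoint (U 0))
      have h2 := opNorm_comp_le (U 0) (adjoint (U 0))
      rw [LinearIsometryEquiv.norm_map] at h2
      have h3 := hU2 0
      simp only [pow_zero, one_mul]
      nlinarith
    | succ t ih =>
      have h := norm_sub_blockStep_le hl hη.le hηl1 (by linarith) (hU2 t) (hJ2 t) hAs hAn
        (sq_norm_le_norm_adjoint_apply_sq (by linarith) (inv t).2.1)
      rw [← hUs] at h
      have h1 := residual_recursion hη.le hl.le hηl2 hηΔ0.le hηΔ hK0 hKΔ (norm_nonneg _)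
        (sq_nonneg (μ ^ t * w)) h (hJw t)
      have e : (μ ^ (t + 1) * w) ^ 2 = μ ^ 2 * (μ ^ t * w) ^ 2 := by ring
      rw [e, pow_succ' ρ, mul_assoc]
      exact h1.trans (mul_le_mul_of_nonneg_left ih (hμ0.trans hμρ))
  refine ⟨?_, hU2 t, hJ2 t, (hJw t).trans (by gcongr)⟩
  have h1 : 0 ≤ K * (μ ^ t * w) ^ 2 := by positivity
  have h2 : 120 * l ^ 2 * w ^ 2 / (a - b) = K * w ^ 2 := by rw [hK]; ring
  rw [h2]
  linarith [hP t]

end GradientStep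

section MatrixBridge

open ContinuousLinearMap
open scoped InnerProductSpace

/-- The operator between Euclidean spaces given by a real matrix. -/
noncomputable def euclideanMap {m n : ℕ} (M : Matrix (Fin m) (Fin n) ℝ) :
    EuclideanSpace ℝ (Fin n) →L[ℝ] EuclideanSpace ℝ (Fin m) :=
  LinearMap.toContinuousLinearMap (Matrix.toEuclideanLin M)

theorem euclideanMap_apply {m n : ℕ} (M : Matrix (Fin m) (Fin n) ℝ)
    (v : EuclideanSpace ℝ (Fin n)) (i : Fin m) : euclideanMap M v i = ∑ j, M i j * v j := by
  simp [euclideanMap, Matrix.toLpLin_apply, Matrix.mulVec, dotProduct]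

theorem euclideanMap_mul {m n k : ℕ} (M : Matrix (Fin m) (Fin n) ℝ)
    (N : Matrix (Fin n) (Fin k) ℝ) :
    euclideanMap (M * N) = euclideanMap M ∘L euclideanMap N := by
  ext v i
  simp [euclideanMap, Matrix.toLpLin_apply]

theorem euclideanMap_add {m n : ℕ} (M N : Matrix (Fin m) (Fin n) ℝ) :
    euclideanMap (M + N) = euclideanMap M + euclideanMap N := by
  simp [euclideanMap]

theorem euclideanMap_sub {m n : ℕ} (M N : Matrix (Fin m) (Fin n) ℝ) :
    euclideanMap (M - N) = euclideanMap M - euclideanMap N := by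
  simp [euclideanMap]

theorem euclideanMap_smul {m n : ℕ} (c : ℝ) (M : Matrix (Fin m) (Fin n) ℝ) :
    euclideanMap (c • M) = c • euclideanMap M := by
  simp [euclideanMap]

theorem adjoint_euclideanMap {m n : ℕ} (M : Matrix (Fin m) (Fin n) ℝ) :
    adjoint (euclideanMap M) = euclideanMap Mᵀ := by
  symm
  rw [eq_adjoint_iff]
  intro x y
  simp only [PiLp.inner_apply, euclideanMap_apply, Matrix.transpose_apply, RCLike.inner_apply,
    conj_trivial, Finset.mul_sum, Finset.sum_mul]
  rw [Finset.sum_comm]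
  refine Finset.sum_congr rfl fun i _ => Finset.sum_congr rfl fun j _ => by ring

theorem norm_euclideanMap_diagonal_apply_le {n : ℕ} {α : Fin n → ℝ} {c : ℝ} (hc : 0 ≤ c)
    (h0 : ∀ i, 0 ≤ α i) (h : ∀ i, α i ≤ c) (y : EuclideanSpace ℝ (Fin n)) :
    ‖euclideanMap (Matrix.diagonal α) y‖ ≤ c * ‖y‖ := by
  refine le_of_sq_le_sq ?_ (by positivity)
  rw [mul_pow, EuclideanSpace.norm_sq_eq, EuclideanSpace.norm_sq_eq, Finset.mul_sum]
  refine Finset.sum_le_sum fun i _ => ?_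
  rw [euclideanMap_apply]
  simp only [Matrix.diagonal_apply, ite_mul, zero_mul, Finset.sum_ite_eq, Finset.mem_univ, if_true,
    norm_mul, mul_pow, Real.norm_eq_abs, sq_abs]
  have := h0 i
  gcongr
  exact h i

theorem le_inner_euclideanMap_diagonal {n : ℕ} {α : Fin n → ℝ} {a : ℝ}
    (h : ∀ i, a ≤ α i) (y : EuclideanSpace ℝ (Fin n)) :
    a * ‖y‖ ^ 2 ≤ ⟪y, euclideanMap (Matrix.diagonal α) y⟫_ℝ := by
  rw [EuclideanSpace.norm_sq_eq, Finset.mul_sum, PiLp.inner_apply]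
  refine Finset.sum_le_sum fun i _ => ?_
  rw [euclideanMap_apply]
  simp only [Matrix.diagonal_apply, ite_mul, zero_mul, Finset.sum_ite_eq, Finset.mem_univ, if_true,
    Real.norm_eq_abs, sq_abs, RCLike.inner_apply, conj_trivial]
  nlinarith [mul_le_mul_of_nonneg_right (h i) (sq_nonneg (y i))]

theorem norm_euclideanMap_apply_le_sigmaMax {m n : ℕ} (M : Matrix (Fin m) (Fin n) ℝ)
    (z : EuclideanSpace ℝ (Fin n)) : ‖euclideanMap M z‖ ≤ sigmaMax M * ‖z‖ := by
  rcases eq_or_ne z 0 with rfl | hz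
  · simp
  have hz' : 0 < ‖z‖ := norm_pos_iff.2 hz
  have h : ‖euclideanMap M (‖z‖⁻¹ • z)‖ ≤ sigmaMax M := by
    refine le_csSup ⟨‖euclideanMap M‖, ?_⟩ ⟨‖z‖⁻¹ • z, by simp [norm_smul, hz], rfl⟩
    rintro c ⟨v, hv, rfl⟩
    change ‖euclideanMap M v‖ ≤ _
    simpa [hv] using (euclideanMap M).le_opNorm v
  rw [map_smul, norm_smul, norm_inv, norm_norm, inv_mul_le_iff₀ hz'] at h
  linarith

theorem sigmaMin_le_norm_euclideanMap_apply {m n : ℕ} (M : Matrix (Fin m) (Fin n) ℝ)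
    (z : EuclideanSpace ℝ (Fin n)) : sigmaMin M * ‖z‖ ≤ ‖euclideanMap M z‖ := by
  rcases eq_or_ne z 0 with rfl | hz
  · simp
  have hz' : 0 < ‖z‖ := norm_pos_iff.2 hz
  have h : sigmaMin M ≤ ‖euclideanMap M (‖z‖⁻¹ • z)‖ := by
    refine csInf_le ⟨0, ?_⟩ ⟨‖z‖⁻¹ • z, by simp [norm_smul, hz], rfl⟩
    rintro c ⟨v, hv, rfl⟩
    positivity
  rw [map_smul, norm_smul, norm_inv, norm_norm, le_inv_mul_iff₀ hz'] at h
  linarith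

theorem sigmaMin_nonneg {m n : ℕ} (M : Matrix (Fin m) (Fin n) ℝ) : 0 ≤ sigmaMin M := by
  refine Real.sInf_nonneg ?_
  rintro c ⟨v, hv, rfl⟩
  positivity

theorem norm_euclideanMap_apply_sq_le {m n : ℕ} {M : Matrix (Fin m) (Fin n) ℝ} {c : ℝ}
    (h : sigmaMax M ^ 2 ≤ c) (z : EuclideanSpace ℝ (Fin n)) :
    ‖euclideanMap M z‖ ^ 2 ≤ c * ‖z‖ ^ 2 := by
  calc _ ≤ (sigmaMax M * ‖z‖) ^ 2 := by gcongr; exact norm_euclideanMap_apply_le_sigmaMax M z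
    _ = sigmaMax M ^ 2 * ‖z‖ ^ 2 := by ring
    _ ≤ _ := by gcongr

theorem le_norm_euclideanMap_apply_sq {m n : ℕ} {M : Matrix (Fin m) (Fin n) ℝ} {c : ℝ}
    (h : c ≤ sigmaMin M ^ 2) (z : EuclideanSpace ℝ (Fin n)) :
    c * ‖z‖ ^ 2 ≤ ‖euclideanMap M z‖ ^ 2 := by
  have h0 := sigmaMin_nonneg M
  calc _ ≤ sigmaMin M ^ 2 * ‖z‖ ^ 2 := by gcongr
    _ = (sigmaMin M * ‖z‖) ^ 2 := by ring
    _ ≤ _ := by gcongr; exact sigmaMin_le_norm_euclideanMap_apply M z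

theorem Fin.sum_univ_castLE_add {d r : ℕ} (h : r ≤ d) (f : Fin d → ℝ) :
    ∑ k, f k = ∑ i : Fin r, f (Fin.castLE h i) +
      ∑ j : Fin (d - r), f ⟨r + (j : ℕ), by have := j.isLt; omega⟩ := by
  rw [← (finCongr (Nat.add_sub_cancel' h)).sum_comp, Fin.sum_univ_add]
  rfl

theorem norm_topBlock_sq_add_botBlock_sq {d r : ℕ} (h : r ≤ d) (X : Matrix (Fin d) (Fin r) ℝ)
    (z : EuclideanSpace ℝ (Fin r)) :
    ‖euclideanMap (topBlock h X) z‖ ^ 2 + ‖euclideanMap (botBlock X) z‖ ^ 2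
      = ‖euclideanMap X z‖ ^ 2 := by
  simp only [EuclideanSpace.norm_sq_eq]
  rw [Fin.sum_univ_castLE_add h]
  simp only [euclideanMap_apply]
  rfl

theorem transpose_mul_self_eq_blocks {d r : ℕ} (h : r ≤ d) (X : Matrix (Fin d) (Fin r) ℝ) :
    Xᵀ * X = (topBlock h X)ᵀ * topBlock h X + (botBlock X)ᵀ * botBlock X := by
  ext i j
  simp only [Matrix.mul_apply, Matrix.add_apply, Matrix.transpose_apply]
  rw [Fin.sum_univ_castLE_add h]
  rfl

theorem euclideanMap_transpose_mul_self {d r : ℕ} (h : r ≤ d) (X : Matrix (Fin d) (Fin r) ℝ) :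
    euclideanMap (Xᵀ * X) =
      gramSum (euclideanMap (topBlock h X)) (euclideanMap (botBlock X)) := by
  rw [transpose_mul_self_eq_blocks h, euclideanMap_add, euclideanMap_mul, euclideanMap_mul,
    gramSum, adjoint_euclideanMap, adjoint_euclideanMap]

theorem gdIter_succ_apply {d r : ℕ} (lam : Fin d → ℝ) (η : ℝ) (X0 : Matrix (Fin d) (Fin r) ℝ)
    (t : ℕ) (i : Fin d) (j : Fin r) :
    gdIter (Matrix.diagonal lam) η X0 (t + 1) i j =
      gdIter (Matrix.diagonal lam) η X0 t i j + η * (lam i * gdIter (Matrix.diagonal lam) η X0 t i j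
        - (gdIter (Matrix.diagonal lam) η X0 t *
          ((gdIter (Matrix.diagonal lam) η X0 t)ᵀ * gdIter (Matrix.diagonal lam) η X0 t)) i j) := by
  rw [← Matrix.mul_assoc, gdIter, Matrix.sub_mul]
  simp [Matrix.diagonal_mul]

theorem euclideanMap_topBlock_gdIter_succ {d r : ℕ} (h : r ≤ d) (lam : Fin d → ℝ) (η : ℝ)
    (X0 : Matrix (Fin d) (Fin r) ℝ) (t : ℕ) :
    euclideanMap (topBlock h (gdIter (Matrix.diagonal lam) η X0 (t + 1))) =
      blockStep η (euclideanMap (Matrix.diagonal fun i => lam (Fin.castLE h i)))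
        (gramSum (euclideanMap (topBlock h (gdIter (Matrix.diagonal lam) η X0 t)))
          (euclideanMap (botBlock (gdIter (Matrix.diagonal lam) η X0 t))))
        (euclideanMap (topBlock h (gdIter (Matrix.diagonal lam) η X0 t))) := by
  rw [blockStep, ← euclideanMap_transpose_mul_self, ← euclideanMap_mul, ← euclideanMap_mul,
    ← euclideanMap_sub, ← euclideanMap_smul, ← euclideanMap_add]
  congr 1
  ext i j
  simp only [Matrix.add_apply, Matrix.smul_apply, Matrix.sub_apply, Matrix.diagonal_mul,
    smul_eq_mul]
  exact gdIter_succ_apply lam η X0 t (Fin.castLE h i) j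

theorem euclideanMap_botBlock_gdIter_succ {d r : ℕ} (h : r ≤ d) (lam : Fin d → ℝ) (η : ℝ)
    (X0 : Matrix (Fin d) (Fin r) ℝ) (t : ℕ) :
    euclideanMap (botBlock (gdIter (Matrix.diagonal lam) η X0 (t + 1))) =
      blockStep η (euclideanMap (Matrix.diagonal fun i : Fin (d - r) =>
          lam ⟨r + (i : ℕ), by have := i.isLt; omega⟩))
        (gramSum (euclideanMap (topBlock h (gdIter (Matrix.diagonal lam) η X0 t)))
          (euclideanMap (botBlock (gdIter (Matrix.diagonal lam) η X0 t))))
        (euclideanMap (botBlock (gdIter (Matrix.diagonal lam) η X0 t))) := by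
  rw [blockStep, ← euclideanMap_transpose_mul_self, ← euclideanMap_mul, ← euclideanMap_mul,
    ← euclideanMap_sub, ← euclideanMap_smul, ← euclideanMap_add]
  congr 1
  ext i j
  simp only [Matrix.add_apply, Matrix.smul_apply, Matrix.sub_apply, Matrix.diagonal_mul,
    smul_eq_mul]
  exact gdIter_succ_apply lam η X0 t ⟨r + (i : ℕ), by have := i.isLt; omega⟩ j

theorem sum_sq_le_mul_norm_euclideanMap_sq {m n : ℕ} (M : Matrix (Fin m) (Fin n) ℝ) :
    ∑ i, ∑ j, M i j ^ 2 ≤ n * ‖euclideanMap M‖ ^ 2 := by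
  rw [Finset.sum_comm]
  have h : ∀ j ∈ Finset.univ, ∑ i, M i j ^ 2 ≤ ‖euclideanMap M‖ ^ 2 := fun j _ => by
    have h1 := (euclideanMap M).le_opNorm (EuclideanSpace.single j 1)
    rw [PiLp.norm_single, norm_one, mul_one] at h1
    have h2 : ‖euclideanMap M (EuclideanSpace.single j 1)‖ ^ 2 = ∑ i, M i j ^ 2 := by
      rw [EuclideanSpace.norm_sq_eq]
      simp [euclideanMap_apply]
    rw [← h2]
    gcongr
  simpa using Finset.sum_le_card_nsmul _ _ _ h

theorem sum_mul_transpose_sq_le {m n k : ℕ} (M : Matrix (Fin m) (Fin k) ℝ)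
    (N : Matrix (Fin n) (Fin k) ℝ) :
    ∑ i, ∑ j, (M * Nᵀ) i j ^ 2 ≤ (∑ i, ∑ l, M i l ^ 2) * ∑ j, ∑ l, N j l ^ 2 := by
  rw [Finset.sum_mul_sum]
  refine Finset.sum_le_sum fun i _ => Finset.sum_le_sum fun j _ => ?_
  simpa [Matrix.mul_apply] using Finset.sum_mul_sq_le_sq_mul_sq Finset.univ (M i) (N j)

theorem frobNorm_sq_sub_mul_transpose_le {d r : ℕ} (h : r ≤ d) (lam : Fin d → ℝ)
    (X : Matrix (Fin d) (Fin r) ℝ) :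
    frobNorm (Matrix.diagonal (fun i : Fin d => if (i : ℕ) < r then lam i else 0) - X * Xᵀ) ^ 2 ≤
      r * ‖euclideanMap (Matrix.diagonal fun i => lam (Fin.castLE h i)) -
          euclideanMap (topBlock h X) ∘L adjoint (euclideanMap (topBlock h X))‖ ^ 2 +
        2 * ((r * ‖euclideanMap (topBlock h X)‖ ^ 2) * (r * ‖euclideanMap (botBlock X)‖ ^ 2)) +
        (r * ‖euclideanMap (botBlock X)‖ ^ 2) ^ 2 := by
  rw [frobNorm, Real.sq_sqrt (by positivity), adjoint_euclideanMap, ← euclideanMap_mul,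
    ← euclideanMap_sub]
  have hU := sum_sq_le_mul_norm_euclideanMap_sq (topBlock h X)
  have hJ := sum_sq_le_mul_norm_euclideanMap_sq (botBlock X)
  have hU0 : 0 ≤ ∑ i, ∑ j, topBlock h X i j ^ 2 := by positivity
  have hJ0 : 0 ≤ ∑ i, ∑ j, botBlock X i j ^ 2 := by positivity
  have h11 := sum_sq_le_mul_norm_euclideanMap_sq
    (Matrix.diagonal (fun i => lam (Fin.castLE h i)) - topBlock h X * (topBlock h X)ᵀ)
  have h12 := (sum_mul_transpose_sq_le (topBlock h X) (botBlock X)).trans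
    (mul_le_mul hU hJ hJ0 (by positivity))
  have h21 := (sum_mul_transpose_sq_le (botBlock X) (topBlock h X)).trans
    (mul_le_mul hJ hU hU0 (by positivity))
  have h22 := (sum_mul_transpose_sq_le (botBlock X) (botBlock X)).trans
    (mul_le_mul hJ hJ hJ0 (by positivity))
  have hne : ∀ (i : Fin r) (j : Fin (d - r)),
      Fin.castLE h i ≠ ⟨r + (j : ℕ), by have := j.isLt; omega⟩ := fun i j e => by
    have := congrArg Fin.val e
    have := i.isLt
    simp at *
    omega
  rw [Fin.sum_univ_castLE_add h]
  simp only [Fin.sum_univ_castLE_add h (fun k => _ ^ 2), Finset.sum_add_distrib]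
  have e11 : ∀ i j, (Matrix.diagonal (fun i : Fin d => if (i : ℕ) < r then lam i else 0) - X * Xᵀ)
      (Fin.castLE h i) (Fin.castLE h j) =
      (Matrix.diagonal (fun i => lam (Fin.castLE h i)) - topBlock h X * (topBlock h X)ᵀ) i j := by
    intro i j
    simp [Matrix.diagonal_apply, Matrix.mul_apply, topBlock]
  have e12 : ∀ i (j : Fin (d - r)),
      (Matrix.diagonal (fun i : Fin d => if (i : ℕ) < r then lam i else 0) - X * Xᵀ)
      (Fin.castLE h i) ⟨r + (j : ℕ), by have := j.isLt; omega⟩ =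
      -(topBlock h X * (botBlock X)ᵀ) i j := by
    intro i j
    simp [Matrix.mul_apply, topBlock, botBlock, hne]
  have e21 : ∀ (i : Fin (d - r)) j,
      (Matrix.diagonal (fun i : Fin d => if (i : ℕ) < r then lam i else 0) - X * Xᵀ)
      ⟨r + (i : ℕ), by have := i.isLt; omega⟩ (Fin.castLE h j) =
      -(botBlock X * (topBlock h X)ᵀ) i j := by
    intro i j
    simp [Matrix.diagonal_apply, Matrix.mul_apply, topBlock, botBlock]
  have e22 : ∀ i j : Fin (d - r),
      (Matrix.diagonal (fun i : Fin d => if (i : ℕ) < r then lam i else 0) - X * Xᵀ)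
      ⟨r + (i : ℕ), by have := i.isLt; omega⟩ ⟨r + (j : ℕ), by have := j.isLt; omega⟩ =
      -(botBlock X * (botBlock X)ᵀ) i j := by
    intro i j
    simp [Matrix.diagonal_apply, Matrix.mul_apply, botBlock]
  simp only [e11, e12, e21, e22, neg_sq]
  linarith

end MatrixBridge

/-- The scalar estimate that turns the linear rate into an iteration count. -/
theorem mul_pow_le_of_log_le {η Δ l ε r : ℝ} (hη : 0 < η) (hΔ : 0 < Δ) (hl : 0 < l)
    (hr : 0 < r) (hε : 0 < ε) (hηl : η * l ≤ 1 / 36) (hηΔ : η * Δ ≤ 1 / 36) {t : ℕ}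
    (ht : 12 / (η * Δ) * Real.log (200 * r * l ^ 2 / (η * Δ ^ 2 * ε)) ≤ t) :
    (1 - η * Δ / 12) ^ t * (491 * r * l ^ 3 / Δ ^ 2) ≤ ε := by
  have hηΔ0 : 0 < η * Δ := by positivity
  obtain ⟨Y, hY⟩ : ∃ Y, Y = 200 * r * l ^ 2 / (η * Δ ^ 2 * ε) := ⟨_, rfl⟩
  have hY0 : 0 < Y := by rw [hY]; positivity
  rw [← hY, div_mul_eq_mul_div, div_le_iff₀ hηΔ0] at ht
  have h1 : Y ≤ Real.exp (t * (η * Δ / 12)) := by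
    rw [← Real.log_le_iff_le_exp hY0]; linarith
  have h2 : (1 - η * Δ / 12) ^ t ≤ Real.exp (-(t * (η * Δ / 12))) := by
    have h3 : 1 - η * Δ / 12 ≤ Real.exp (-(η * Δ / 12)) := by
      have := Real.add_one_le_exp (-(η * Δ / 12)); linarith
    calc _ ≤ Real.exp (-(η * Δ / 12)) ^ t := by gcongr; linarith
      _ = _ := by rw [← Real.exp_nat_mul]; ring_nf
  have h4 : (1 - η * Δ / 12) ^ t ≤ Y⁻¹ := by
    refine h2.trans ?_
    rw [Real.exp_neg]
    gcongr
  calc _ ≤ Y⁻¹ * (491 * r * l ^ 3 / Δ ^ 2) := by gcongr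
    _ = 491 / 200 * (η * l) * ε := by rw [hY]; field_simp
    _ ≤ 491 / 200 * (1 / 36) * ε := by gcongr
    _ ≤ ε := by linarith

/-- The scalar estimate that combines the bounds on the blocks of the residual. -/
theorem le_of_sq_le_block_bounds {F r p u j l Δ ρ w : ℝ} (hr : 1 ≤ r) (hp : 0 ≤ p) (hj : 0 ≤ j)
    (hΔ : 0 < Δ) (hΔl : Δ ≤ l) (hρ : 0 ≤ ρ) (hw : 0 ≤ w)
    (hF : F ^ 2 ≤ r * p ^ 2 + 2 * ((r * u) * (r * j)) + (r * j) ^ 2)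
    (hP : p ≤ ρ * (3 * l + 120 * l ^ 2 * w ^ 2 / Δ)) (hu : u ≤ 2 * l) (hjl : j ≤ 2 * l)
    (hjw : j ≤ 2 * l * (ρ * w) ^ 2) (hwl : w * Δ ≤ 2 * l) (hw2 : w ^ 2 * Δ ≤ 4 * l) :
    F ≤ ρ * (491 * r * l ^ 3 / Δ ^ 2) := by
  have hl : 0 < l := hΔ.trans_le hΔl
  have h1 : F ≤ r * (p + 4 * l * ρ * w) := by
    refine le_of_sq_le_sq (hF.trans ?_) (by positivity)
    have e1 : r * p ^ 2 ≤ r ^ 2 * p ^ 2 := by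
      gcongr; nlinarith
    have e2 : u * j ≤ 2 * l * j := by gcongr
    have e3 : j ^ 2 ≤ 2 * l * j := by rw [sq]; gcongr
    have e4 : 2 * l * j ≤ 2 * l * (2 * l * (ρ * w) ^ 2) := by gcongr
    have e5 : 0 ≤ r ^ 2 * (p * (l * ρ * w)) := by positivity
    have e6 : r ^ 2 * (2 * (u * j) + j ^ 2) ≤ r ^ 2 * (12 * (l * ρ * w) ^ 2) := by
      gcongr; nlinarith
    nlinarith [sq_nonneg (r * (l * ρ * w))]
  have h2 : 3 * l + 120 * l ^ 2 * w ^ 2 / Δ + 4 * l * w ≤ 491 * l ^ 3 / Δ ^ 2 := by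
    rw [le_div_iff₀ (by positivity)]
    have e : (3 * l + 120 * l ^ 2 * w ^ 2 / Δ + 4 * l * w) * Δ ^ 2 =
        3 * l * (Δ * Δ) + 120 * l ^ 2 * (w ^ 2 * Δ) + 4 * l * Δ * (w * Δ) := by
      field_simp
    rw [e]
    have e1 : 3 * l * (Δ * Δ) ≤ 3 * l * (l * l) := by gcongr
    have e2 : 120 * l ^ 2 * (w ^ 2 * Δ) ≤ 120 * l ^ 2 * (4 * l) := by gcongr
    have e3 : 4 * l * Δ * (w * Δ) ≤ 4 * l * l * (2 * l) := by gcongr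
    nlinarith
  calc F ≤ r * (p + 4 * l * ρ * w) := h1
    _ ≤ r * (ρ * (3 * l + 120 * l ^ 2 * w ^ 2 / Δ) + 4 * l * ρ * w) := by gcongr
    _ = r * ρ * (3 * l + 120 * l ^ 2 * w ^ 2 / Δ + 4 * l * w) := by ring
    _ ≤ r * ρ * (491 * l ^ 3 / Δ ^ 2) := by gcongr
    _ = _ := by ring

/-- Theorem 2.1: local linear convergence of gradient descent from the region `R`. -/
theorem local_linear_convergence :
    ∃ C : ℝ, 0 < C ∧
      ∀ (d r : ℕ), 0 < r → ∀ (hrd : r < d) (lam : Fin d → ℝ),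
        (∀ i j : Fin d, i ≤ j → lam j ≤ lam i) →
        (∀ i, 0 ≤ lam i) →
        ∀ η : ℝ, 0 < η →
        0 < lam ⟨r - 1, by omega⟩ - lam ⟨r, hrd⟩ →
        η ≤ (lam ⟨r - 1, by omega⟩ - lam ⟨r, hrd⟩) ^ 2 / (36 * lam ⟨0, by omega⟩ ^ 3) →
        ∀ X0 : Matrix (Fin d) (Fin r) ℝ,
        inR hrd.le (lam ⟨0, by omega⟩) (lam ⟨r - 1, by omega⟩)
          (lam ⟨r - 1, by omega⟩ - lam ⟨r, hrd⟩) X0 →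
        ∀ ε : ℝ, 0 < ε → ∀ t : ℕ,
          (C / (η * (lam ⟨r - 1, by omega⟩ - lam ⟨r, hrd⟩))) *
              Real.log (200 * r * lam ⟨0, by omega⟩ ^ 2 /
                (η * (lam ⟨r - 1, by omega⟩ - lam ⟨r, hrd⟩) ^ 2 * ε)) ≤ (t : ℝ) →
          frobNorm
            (Matrix.diagonal (fun i : Fin d => if (i : ℕ) < r then lam i else 0) -
              gdIter (Matrix.diagonal lam) η X0 t * (gdIter (Matrix.diagonal lam) η X0 t)ᵀ)
            ≤ ε := by
  refine ⟨12, by norm_num, ?_⟩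
  intro d r hr hrd lam hmono hnn η hη hΔ hηle X0 hR ε hε t ht
  obtain ⟨hX, hJ, hU⟩ := hR
  have hal : lam ⟨r - 1, by omega⟩ ≤ lam ⟨0, by omega⟩ := hmono _ _ (Fin.mk_le_mk.2 (Nat.zero_le _))
  have htop : ∀ i : Fin r, lam ⟨r - 1, by omega⟩ ≤ lam (Fin.castLE hrd.le i) := fun i =>
    hmono _ _ (Fin.mk_le_mk.2 (by have := i.isLt; omega))
  have htop' : ∀ i : Fin r, lam (Fin.castLE hrd.le i) ≤ lam ⟨0, by omega⟩ := fun i =>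
    hmono _ _ (Fin.mk_le_mk.2 (Nat.zero_le _))
  have hbot : ∀ i : Fin (d - r), lam ⟨r + (i : ℕ), by have := i.isLt; omega⟩ ≤ lam ⟨r, hrd⟩ :=
    fun i => hmono _ _ (Fin.mk_le_mk.2 (by omega))
  have hb : 0 ≤ lam ⟨r, hrd⟩ := hnn _
  have hA' := fun y => norm_euclideanMap_diagonal_apply_le
    (α := fun i : Fin r => lam (Fin.castLE hrd.le i)) (hnn _) (fun i => hnn _) htop' y
  have hB := fun y => norm_euclideanMap_diagonal_apply_le
    (α := fun i : Fin (d - r) => lam ⟨r + (i : ℕ), by have := i.isLt; omega⟩) hb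
    (fun i => hnn _) hbot y
  have hA := fun y => le_inner_euclideanMap_diagonal
    (α := fun i : Fin r => lam (Fin.castLE hrd.le i)) htop y
  generalize lam ⟨r - 1, by omega⟩ = a at *
  generalize lam ⟨r, hrd⟩ = b at *
  generalize lam ⟨0, by omega⟩ = l at *
  have ha : 0 < a := by linarith
  have hl : 0 < l := by linarith
  have hηl3 : 36 * η * l ^ 3 ≤ (a - b) ^ 2 := by
    rw [le_div_iff₀ (by positivity)] at hηle; linarith
  have hΔl : a - b ≤ l := by linarith
  have hηl : η * l ≤ 1 / 36 := by
    refine le_of_mul_le_mul_right (a := l ^ 2) ?_ (by positivity)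
    nlinarith
  have hηΔ : η * (a - b) ≤ 1 / 36 := (mul_le_mul_of_nonneg_left hΔl hη.le).trans hηl
  obtain ⟨w, hw, hw2⟩ : ∃ w : ℝ, 0 ≤ w ∧ w ^ 2 = 4 * a / (a - b) - 2 :=
    ⟨√(4 * a / (a - b) - 2), Real.sqrt_nonneg _, Real.sq_sqrt (by
      rw [sub_nonneg, le_div_iff₀ hΔ]; linarith)⟩
  have hw2' : w ^ 2 * (a - b) = 4 * a - 2 * (a - b) := by
    rw [hw2]; field_simp
  have hwl : w * (a - b) ≤ 2 * l := by
    refine le_of_sq_le_sq ?_ (by positivity)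
    have e : (w * (a - b)) ^ 2 = (4 * a - 2 * (a - b)) * (a - b) := by rw [← hw2']; ring
    rw [e]
    nlinarith [mul_le_mul hal hΔl hΔ.le hl.le]
  obtain ⟨hP, hUn, hJn, hJw⟩ := blockStep_iterate_bounds
    (U := fun t => euclideanMap (topBlock hrd.le (gdIter (Matrix.diagonal lam) η X0 t)))
    (J := fun t => euclideanMap (botBlock (gdIter (Matrix.diagonal lam) η X0 t)))
    (w := w) hη
    (euclideanMap_topBlock_gdIter_succ hrd.le lam η X0)
    (euclideanMap_botBlock_gdIter_succ hrd.le lam η X0)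
    (by rw [adjoint_euclideanMap, Matrix.diagonal_transpose]) hA hA' hB hb
    (by linarith) hal hηl3
    (fun z => by
      rw [norm_topBlock_sq_add_botBlock_sq]
      exact norm_euclideanMap_apply_sq_le hX z)
    (fun z => by
      have := le_norm_euclideanMap_apply_sq hU z
      have h0 : 0 ≤ (a - b) * ‖z‖ ^ 2 := by positivity
      refine le_trans ?_ this
      linarith)
    hw
    (fun z => by
      have h1 := le_norm_euclideanMap_apply_sq hU z
      have h2 := norm_euclideanMap_apply_sq_le hJ z
      refine le_of_sq_le_sq (h2.trans ?_) (by positivity)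
      rw [mul_pow]
      have e : (a - (a - b) / 2) * ‖z‖ ^ 2 = w ^ 2 * ((a - b) / 4 * ‖z‖ ^ 2) := by
        have : a - (a - b) / 2 = w ^ 2 * (a - b) / 4 := by rw [hw2']; ring
        rw [this]; ring
      rw [e]
      exact mul_le_mul_of_nonneg_left h1 (sq_nonneg w))
    (by linarith) hwl t
  have hF := frobNorm_sq_sub_mul_transpose_le hrd.le lam (gdIter (Matrix.diagonal lam) η X0 t)
  refine le_trans ?_ (mul_pow_le_of_log_le hη hΔ hl (Nat.cast_pos.2 hr) hε hηl hηΔ ht)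
  have hr1 : (1 : ℝ) ≤ r := by exact_mod_cast hr
  exact le_of_sq_le_block_bounds hr1 (norm_nonneg _) (sq_nonneg _) hΔ hΔl
    (pow_nonneg (by linarith) t) hw hF hP hUn hJn hJw hwl (by linarith)
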